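/- arXiv:1804.05043 — 2 statements merged into one kernel-verified Lean document; each statement's English description precedes it below -/
import Mathlib

section
/- Let A be a commutative local ring of length two (as a module over itself) with maximal ideal m and perfect residue field F. Then A is isomorphic as a ring to either F[t]/(t²) or to W₂(F), the ring of Witt vectors of length two over F. -/
open IsLocalRing Polynomial

section LengthTwo

variable {A : Type*} [CommRing A] [IsLocalRing A]

lemma isAtom_maximalIdeal_of_compositionSeries
    (h : ∃ s : CompositionSeries (Submodule A A), s.head = ⊥ ∧ s.last = ⊤ ∧ s.length = 2) :
    IsAtom (maximalIdeal A) := by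
  obtain ⟨⟨n, f, hf⟩, h0, h1, h2⟩ := h
  dsimp only at h2
  subst h2
  have e0 : f 0 = ⊥ := h0
  have e2 : f 2 = ⊤ := h1
  have s0 : f 0 ⋖ f 1 := hf 0
  have s1 : f 1 ⋖ f 2 := hf 1
  rw [e0, bot_covBy_iff] at s0
  rw [e2, covBy_top_iff] at s1
  have : f 1 = maximalIdeal A := eq_maximalIdeal (Ideal.isMaximal_def.2 s1)
  rwa [this] at s0

lemma maximalIdeal_eq_span_of_isAtom (h : IsAtom (maximalIdeal A)) {x : A}
    (hx : x ∈ maximalIdeal A) (hx0 : x ≠ 0) : maximalIdeal A = Ideal.span {x} := by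
  refine ((h.le_iff.1 ((Ideal.span_singleton_le_iff_mem _).2 hx)).resolve_left ?_).symm
  simpa using hx0

lemma mul_eq_zero_of_isAtom_maximalIdeal (h : IsAtom (maximalIdeal A)) {x y : A}
    (hx : x ∈ maximalIdeal A) (hy : y ∈ maximalIdeal A) : x * y = 0 := by
  by_contra hxy
  have hspan := maximalIdeal_eq_span_of_isAtom h (Ideal.mul_mem_left _ x hy) hxy
  obtain ⟨a, ha⟩ := Ideal.mem_span_singleton'.1 (hspan ▸ hy)
  have hu : IsUnit (1 - a * x) := by
    by_contra hn
    have := Ideal.add_mem _ ((mem_maximalIdeal _).2 hn) (Ideal.mul_mem_left _ a hx)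
    rw [sub_add_cancel] at this
    exact (Ideal.ne_top_iff_one _).1 (maximalIdeal.isMaximal A).ne_top this
  have hy0 : (1 - a * x) * y = 0 := by linear_combination -ha
  rw [hu.mul_right_eq_zero] at hy0
  simp [hy0] at hxy

lemma pow_eq_zero_of_isAtom_maximalIdeal (h : IsAtom (maximalIdeal A)) {x : A}
    (hx : x ∈ maximalIdeal A) {n : ℕ} (hn : 2 ≤ n) : x ^ n = 0 :=
  pow_eq_zero_of_le hn (by rw [sq, mul_eq_zero_of_isAtom_maximalIdeal h hx hx])

/-- A local ring of length two with a coefficient field is the ring of dual numbers over it. -/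
lemma nonempty_ringEquiv_quotient_X_sq_of_section (h : IsAtom (maximalIdeal A))
    (σ : ResidueField A →+* A) (hσ : ∀ x, residue A (σ x) = x) :
    Nonempty (A ≃+* ((ResidueField A)[X] ⧸ Ideal.span {(X : (ResidueField A)[X]) ^ 2})) := by
  obtain ⟨ε, hε, hε0⟩ := (Submodule.ne_bot_iff _).1 h.1
  have hspan := maximalIdeal_eq_span_of_isAtom h hε hε0
  let φ : (ResidueField A)[X] →+* A := eval₂RingHom σ ε
  have hφX : φ X = ε := eval₂_X _ _
  have hφC (c) : φ (C c) = σ c := eval₂_C _ _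
  have hmem (a : A) : a - σ (residue A a) ∈ maximalIdeal A := by
    rw [← residue_eq_zero_iff, map_sub, hσ, sub_self]
  have hsurj : Function.Surjective φ := by
    intro a
    obtain ⟨c, hc⟩ := Ideal.mem_span_singleton'.1 (hspan ▸ hmem a)
    refine ⟨C (residue A a) + C (residue A c) * X, ?_⟩
    rw [map_add, map_mul, hφX, hφC, hφC]
    linear_combination hc - mul_eq_zero_of_isAtom_maximalIdeal h (hmem c) hε
  have hker : RingHom.ker φ = Ideal.span {(X : (ResidueField A)[X]) ^ 2} := by
    refine le_antisymm (fun f hf => ?_) ?_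
    · have hsq : φ (X ^ 2) = 0 := by
        rw [map_pow, hφX, pow_eq_zero_of_isAtom_maximalIdeal h hε le_rfl]
      have hdecomp : f = X ^ 2 * f.divX.divX + (C (f.coeff 1) * X + C (f.coeff 0)) := by
        have h1 := f.divX_mul_X_add
        have h2 := f.divX.divX_mul_X_add
        rw [coeff_divX] at h2
        linear_combination -h1 - X * h2
      have hf' : σ (f.coeff 1) * ε + σ (f.coeff 0) = 0 := by
        have := RingHom.mem_ker.1 hf
        rwa [hdecomp, map_add, map_mul, hsq, zero_mul, zero_add, map_add, map_mul, hφX, hφC,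
          hφC] at this
      have hc0 : f.coeff 0 = 0 := by
        have := congrArg (residue A) hf'
        rwa [map_add, map_mul, (residue_eq_zero_iff ε).2 hε, mul_zero, zero_add, map_zero,
          hσ] at this
      have hc1 : f.coeff 1 = 0 := by
        by_contra hne
        rw [hc0, map_zero, add_zero, ((isUnit_iff_ne_zero.2 hne).map σ).mul_right_eq_zero] at hf'
        exact hε0 hf'
      rw [hc0, hc1] at hdecomp
      exact Ideal.mem_span_singleton.2 ⟨f.divX.divX, by simpa using hdecomp⟩
    · rw [Ideal.span_singleton_le_iff_mem, RingHom.mem_ker, map_pow, hφX,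
        pow_eq_zero_of_isAtom_maximalIdeal h hε le_rfl]
  exact ⟨((Ideal.quotEquivOfEq hker.symm).trans
    (RingHom.quotientKerEquivOfSurjective hsurj)).symm⟩

end LengthTwo

section CoefficientField

variable {A : Type*} [CommRing A] [IsLocalRing A]

lemma exists_section_residue_of_charZero [CharZero (ResidueField A)]
    (h : IsNilpotent (maximalIdeal A)) :
    ∃ σ : ResidueField A →+* A, ∀ x, residue A (σ x) = x := by
  have hunit (n : ℤ) (hn : n ≠ 0) : IsUnit (n : A) := by
    rw [← residue_ne_zero_iff_isUnit, map_intCast]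
    exact_mod_cast hn
  let g : ℚ →+* A := IsLocalization.lift (M := nonZeroDivisors ℤ) (g := Int.castRingHom A)
    fun y => hunit y (nonZeroDivisors.coe_ne_zero y)
  let : Algebra ℚ A := g.toAlgebra
  obtain ⟨s, hs⟩ := exists_isTranscendenceBasis ℚ (ResidueField A)
  have := hs.isAlgebraic_field
  have : Algebra.FormallySmooth ℚ (ResidueField A) :=
    .of_algebraicIndependent_of_isSeparable hs.1
  obtain ⟨σ, hσ⟩ := Algebra.FormallySmooth.exists_lift (maximalIdeal A) h
    (RingHom.toRatAlgHom (RingHom.id (A ⧸ maximalIdeal A)) : ResidueField A →ₐ[ℚ] _)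
  exact ⟨σ, fun x => DFunLike.congr_fun hσ x⟩

lemma exists_section_residue_of_charP (p : ℕ) [Fact p.Prime] [CharP A p]
    [CharP (ResidueField A) p] [PerfectRing (ResidueField A) p]
    (h : ∀ x ∈ maximalIdeal A, x ^ p = 0) :
    ∃ σ : ResidueField A →+* A, ∀ x, residue A (σ x) = x := by
  let τ : ResidueField A →+* A := Ideal.Quotient.lift (maximalIdeal A) (frobenius A p) h
  have hτ (a : A) : τ (residue A a) = a ^ p := rfl
  refine ⟨τ.comp (frobeniusEquiv (ResidueField A) p).symm, fun x => ?_⟩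
  obtain ⟨y, rfl⟩ := (frobeniusEquiv (ResidueField A) p).surjective x
  obtain ⟨a, rfl⟩ := residue_surjective y
  simp [hτ, frobenius_def]

end CoefficientField

section MixedCharacteristic

variable {A : Type*} [CommRing A] [IsLocalRing A]

lemma WittVector.ghostComponent_one_apply {R : Type*} [CommRing R] (p : ℕ) [Fact p.Prime]
    (x : WittVector p R) : ghostComponent 1 x = x.coeff 0 ^ p + p * x.coeff 1 := by
  rw [ghostComponent_apply, aeval_wittPolynomial]
  simp [Finset.sum_range_succ]

/-- The first ghost component on `W(A)` descends to an isomorphism `W₂(F) ≃ A`. -/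
lemma nonempty_ringEquiv_truncatedWittVector (h : IsAtom (maximalIdeal A)) (p : ℕ)
    [Fact p.Prime] [CharP (ResidueField A) p] [PerfectRing (ResidueField A) p]
    (hp : (p : A) ≠ 0) :
    Nonempty (A ≃+* TruncatedWittVector p 2 (ResidueField A)) := by
  have hpm : (p : A) ∈ maximalIdeal A := by
    rw [← residue_eq_zero_iff, map_natCast, CharP.cast_eq_zero]
  have hp2 : 2 ≤ p := (Fact.out : p.Prime).two_le
  have hspan := maximalIdeal_eq_span_of_isAtom h hpm hp
  have hroot (a : A) : ∃ b : A, a - b ^ p ∈ maximalIdeal A := by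
    obtain ⟨y, hy⟩ := (frobeniusEquiv (ResidueField A) p).surjective (residue A a)
    obtain ⟨b, rfl⟩ := residue_surjective y
    refine ⟨b, ?_⟩
    rw [← residue_eq_zero_iff, map_sub, map_pow, ← hy, frobeniusEquiv_apply, frobenius_def,
      sub_self]
  let w : WittVector p A →+* A := WittVector.ghostComponent 1
  let t : WittVector p A →+* TruncatedWittVector p 2 (ResidueField A) :=
    (WittVector.truncate 2).comp (WittVector.map (residue A))
  have ht : Function.Surjective t :=
    (WittVector.truncate_surjective p 2 _).comp (WittVector.map_surjective _ residue_surjective)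
  have hw : Function.Surjective w := by
    intro a
    obtain ⟨b, hb⟩ := hroot a
    obtain ⟨c, hc⟩ := Ideal.mem_span_singleton'.1 (hspan ▸ hb)
    refine ⟨WittVector.mk p fun n => if n = 0 then b else c, ?_⟩
    rw [WittVector.ghostComponent_one_apply]
    simp only [WittVector.coeff_mk, if_true, one_ne_zero, if_false]
    linear_combination hc
  have hker : RingHom.ker w = RingHom.ker t := by
    ext x
    have hxt : x ∈ RingHom.ker t ↔
        x.coeff 0 ∈ maximalIdeal A ∧ x.coeff 1 ∈ maximalIdeal A := by
      change WittVector.map (residue A) x ∈ RingHom.ker (WittVector.truncate 2) ↔ _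
      rw [WittVector.mem_ker_truncate]
      simp only [WittVector.map_coeff, residue_eq_zero_iff]
      exact ⟨fun H => ⟨H 0 (by simp), H 1 (by simp)⟩, fun H i hi => by
        interval_cases i <;> simp [H]⟩
    rw [hxt, RingHom.mem_ker, WittVector.ghostComponent_one_apply]
    constructor
    · intro hx
      have h0 : x.coeff 0 ∈ maximalIdeal A := by
        refine (maximalIdeal.isMaximal A).isPrime.mem_of_pow_mem p ?_
        rw [eq_neg_of_add_eq_zero_left hx]
        exact neg_mem (Ideal.mul_mem_right _ _ hpm)
      refine ⟨h0, fun hu => hp ?_⟩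
      rwa [pow_eq_zero_of_isAtom_maximalIdeal h h0 hp2, zero_add, hu.mul_left_eq_zero] at hx
    · rintro ⟨h0, h1⟩
      rw [pow_eq_zero_of_isAtom_maximalIdeal h h0 hp2,
        mul_eq_zero_of_isAtom_maximalIdeal h hpm h1, add_zero]
  exact ⟨(RingHom.quotientKerEquivOfSurjective hw).symm.trans
    ((Ideal.quotEquivOfEq hker).trans (RingHom.quotientKerEquivOfSurjective ht))⟩

end MixedCharacteristic


/-- Let `A` be a commutative local ring of length two (as a module over itself) with
maximal ideal `m` and perfect residue field `F`.  Then `A` is isomorphic as a ring to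
either `F[t]/(t²)` or to `W₂(F)`, the ring of Witt vectors of length two over `F`. -/
theorem stmt_0 (A : Type*) [CommRing A] [IsLocalRing A]
    (hlen : ∃ s : CompositionSeries (Submodule A A),
      s.head = ⊥ ∧ s.last = ⊤ ∧ s.length = 2)
    [PerfectField (IsLocalRing.ResidueField A)] :
    Nonempty (A ≃+* (Polynomial (IsLocalRing.ResidueField A) ⧸
        Ideal.span {(Polynomial.X : Polynomial (IsLocalRing.ResidueField A)) ^ 2})) ∨
      ∃ (p : ℕ) (_ : Fact p.Prime),
        Nonempty (A ≃+* TruncatedWittVector p 2 (IsLocalRing.ResidueField A)) := by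
  have h := isAtom_maximalIdeal_of_compositionSeries hlen
  obtain ⟨p, hp⟩ := CharP.exists (ResidueField A)
  rcases CharP.char_is_prime_or_zero (ResidueField A) p with hprime | rfl
  · have : Fact p.Prime := ⟨hprime⟩
    by_cases hpA : (p : A) = 0
    · left
      have : CharP A p := by
        obtain ⟨q, hq⟩ := CharP.exists A
        have hqp : q ∣ p := (CharP.cast_eq_zero_iff A q p).1 hpA
        rcases (Nat.dvd_prime hprime).1 hqp with rfl | rfl
        · exact (CharP.char_ne_one A 1 rfl).elim
        · exact hq
      obtain ⟨σ, hσ⟩ := exists_section_residue_of_charP p fun x hx =>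
        pow_eq_zero_of_isAtom_maximalIdeal h hx hprime.two_le
      exact nonempty_ringEquiv_quotient_X_sq_of_section h σ hσ
    · exact Or.inr ⟨p, this, nonempty_ringEquiv_truncatedWittVector h p hpA⟩
  · left
    have := CharP.charP_to_charZero (ResidueField A)
    have hnil : IsNilpotent (maximalIdeal A) := by
      refine ⟨2, ?_⟩
      rw [sq, Submodule.zero_eq_bot, eq_bot_iff, Ideal.mul_le]
      exact fun x hx y hy => mul_eq_zero_of_isAtom_maximalIdeal h hx hy
    obtain ⟨σ, hσ⟩ := exists_section_residue_of_charZero hnil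
    exact nonempty_ringEquiv_quotient_X_sq_of_section h σ hσ
end

section
/- Let Γ be a finite group, N ⊴ Γ a normal subgroup, and β a one-dimensional character of N with stabiliser C in Γ. If β extends to C, then the number of irreducible complex representations of Γ lying above β equals the number of irreducible complex representations of the quotient C/N. -/
open CategoryTheory

/-- A finite-dimensional representation `X` of `Γ` lies above the one-dimensional
character `β` of the subgroup `N` if it contains a nonzero vector on which `N` acts
through `β` (for `X` irreducible this says the restriction of `X` to `N` contains `β`
as a constituent). -/
def LiesAbove {Γ : Type} [Group Γ] (N : Subgroup Γ) (β : N →* ℂˣ)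
    (X : FDRep ℂ Γ) : Prop :=
  ∃ v : X, v ≠ 0 ∧ ∀ n : N, FDRep.ρ X (n : Γ) v = (β n : ℂ) • v

namespace FDRep

universe u v

variable {k : Type u} {G : Type v} [Field k] [Monoid G]

/-- The morphism in `FDRep k G` given by an intertwining map. -/
noncomputable def homOfIntertwiningMap {X Y : FDRep k G}
    (f : Representation.IntertwiningMap X.ρ Y.ρ) : X ⟶ Y where
  hom := ConcreteCategory.ofHom (C := FGModuleCat k) (X := X.V) (Y := Y.V) f.toLinearMap
  comm g := by
    ext x
    exact Representation.IntertwiningMap.isIntertwining _ _ f g x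

/-- The intertwining map underlying a morphism in `FDRep k G`. -/
def intertwiningMapOfHom {X Y : FDRep k G} (f : X ⟶ Y) :
    Representation.IntertwiningMap X.ρ Y.ρ where
  toLinearMap := f.hom.hom.hom
  isIntertwining' g := by
    ext x
    exact ConcreteCategory.congr_hom (f.comm g) x

lemma hom_ext_apply {X Y : FDRep k G} {f g : X ⟶ Y}
    (h : ∀ x, intertwiningMapOfHom f x = intertwiningMapOfHom g x) : f = g := by
  ext x
  exact h x

lemma nonempty_iso_iff {X Y : FDRep k G} :
    Nonempty (X ≅ Y) ↔ Nonempty (Representation.Equiv X.ρ Y.ρ) := by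
  constructor
  · rintro ⟨i⟩
    refine ⟨(intertwiningMapOfHom i.hom).ofBijective ⟨?_, ?_⟩⟩
    · refine Function.LeftInverse.injective (g := intertwiningMapOfHom i.inv) fun x ↦ ?_
      exact ConcreteCategory.congr_hom i.hom_inv_id x
    · refine Function.RightInverse.surjective (g := intertwiningMapOfHom i.inv) fun x ↦ ?_
      exact ConcreteCategory.congr_hom i.inv_hom_id x
  · rintro ⟨e⟩
    exact ⟨⟨homOfIntertwiningMap e.toIntertwiningMap, homOfIntertwiningMap e.symm.toIntertwiningMap,
      hom_ext_apply e.symm_apply_apply, hom_ext_apply e.apply_symm_apply⟩⟩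

lemma isIso_of_bijective {X Y : FDRep k G} (f : X ⟶ Y)
    (hf : Function.Bijective (intertwiningMapOfHom f)) : IsIso f := by
  let e := (intertwiningMapOfHom f).ofBijective hf
  exact ⟨homOfIntertwiningMap e.symm.toIntertwiningMap,
      hom_ext_apply e.symm_apply_apply, hom_ext_apply e.apply_symm_apply⟩

lemma injective_of_mono {X Y : FDRep k G} (f : X ⟶ Y) [Mono f] :
    Function.Injective (intertwiningMapOfHom f) := by
  let K := (intertwiningMapOfHom f).ker
  let i : FDRep.of K.toRepresentation ⟶ X := homOfIntertwiningMap
    ⟨K.toSubmodule.subtype, fun _ ↦ rfl⟩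
  have h0 : i = 0 := by
    rw [← cancel_mono f, Limits.zero_comp]
    exact hom_ext_apply fun x ↦ x.2
  refine (injective_iff_map_eq_zero (intertwiningMapOfHom f).toLinearMap).2 fun x hx ↦ ?_
  exact congr(intertwiningMapOfHom $h0 ⟨x, hx⟩)

lemma simple_iff_isIrreducible {X : FDRep k G} :
    Simple X ↔ Representation.IsIrreducible X.ρ := by
  constructor
  · intro hX
    have hnt : Nontrivial (Subrepresentation X.ρ) := by
      refine ⟨⊥, ⊤, fun h ↦ id_nonzero X (hom_ext_apply fun x ↦ ?_)⟩
      have hx : x ∈ (⊥ : Subrepresentation X.ρ) := h ▸ Submodule.mem_top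
      exact hx
    refine ⟨fun p ↦ or_iff_not_imp_left.2 fun hp ↦ ?_⟩
    let i : FDRep.of p.toRepresentation ⟶ X := homOfIntertwiningMap
      ⟨p.toSubmodule.subtype, fun _ ↦ rfl⟩
    have : Mono i := ⟨fun a b hab ↦ hom_ext_apply fun x ↦
      Subtype.ext congr(intertwiningMapOfHom $hab x)⟩
    have hi : i ≠ 0 := by
      intro h
      refine hp (eq_bot_iff.2 fun x hx ↦ ?_)
      exact congr(intertwiningMapOfHom $h ⟨x, hx⟩)
    have := isIso_of_mono_of_nonzero hi
    refine eq_top_iff.2 fun x _ ↦ ?_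
    have hx : (intertwiningMapOfHom (inv i) x : p.toSubmodule).1 = x :=
      congr(intertwiningMapOfHom $(IsIso.inv_hom_id i) x)
    exact hx ▸ (intertwiningMapOfHom (inv i) x : p.toSubmodule).2
  · intro hX
    refine ⟨fun {Y} f _ ↦ ⟨fun hf h0 ↦ ?_, fun h0 ↦ ?_⟩⟩
    · refine bot_ne_top (α := Subrepresentation X.ρ) (eq_top_iff.2 fun x _ ↦ ?_)
      have hx : intertwiningMapOfHom f (intertwiningMapOfHom (inv f) x) = x :=
        congr(intertwiningMapOfHom $(IsIso.inv_hom_id f) x)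
      subst h0
      rw [← hx]
      exact Submodule.zero_mem _
    · refine isIso_of_bijective f ⟨injective_of_mono f, fun x ↦ ?_⟩
      rcases eq_bot_or_eq_top (intertwiningMapOfHom f).range with h | h
      · refine absurd (hom_ext_apply fun y ↦ ?_) h0
        have hy : intertwiningMapOfHom f y ∈ (intertwiningMapOfHom f).range := ⟨y, rfl⟩
        rw [h] at hy
        exact hy
      · have hx : x ∈ (intertwiningMapOfHom f).range := h ▸ Submodule.mem_top
        exact hx

end FDRep

namespace Representation

/-- The subrepresentation generated by a subspace `W`. -/
def generatedBy {k G V : Type*} [Field k] [Group G] [AddCommGroup V] [Module k V]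
    (ρ : Representation k G V) (W : Submodule k V) : Subrepresentation ρ where
  toSubmodule := ⨆ g, W.map (ρ g)
  apply_mem_toSubmodule g v hv := by
    suffices h : (⨆ h, W.map (ρ h)) ≤ (⨆ h, W.map (ρ h)).comap (ρ g) from h hv
    refine iSup_le fun h ↦ ?_
    rintro _ ⟨w, hw, rfl⟩
    refine Submodule.mem_iSup_of_mem (g * h) ⟨w, hw, ?_⟩
    rw [map_mul, Module.End.mul_apply]

section generatedBy

variable {k G V : Type*} [Field k] [Group G] [AddCommGroup V] [Module k V]
  {ρ : Representation k G V} {W : Submodule k V}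

lemma le_generatedBy : W ≤ (ρ.generatedBy W).toSubmodule := fun w hw ↦
  Submodule.mem_iSup_of_mem 1 ⟨w, hw, by simp⟩

lemma generatedBy_le {U : Subrepresentation ρ} (h : W ≤ U.toSubmodule) :
    ρ.generatedBy W ≤ U := by
  suffices h' : (⨆ g, W.map (ρ g)) ≤ U.toSubmodule from h'
  refine iSup_le fun g ↦ ?_
  rintro _ ⟨w, hw, rfl⟩
  exact U.apply_mem_toSubmodule g (h hw)

lemma generatedBy_comap_subtype :
    (ρ.generatedBy W).toRepresentation.generatedBy
      (W.comap (ρ.generatedBy W).toSubmodule.subtype) = ⊤ := by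
  set U := ρ.generatedBy W
  set T := U.toRepresentation.generatedBy (W.comap U.toSubmodule.subtype)
  let T' : Subrepresentation ρ :=
    { toSubmodule := T.toSubmodule.map U.toSubmodule.subtype
      apply_mem_toSubmodule := by
        rintro g _ ⟨t, ht, rfl⟩
        exact ⟨_, T.apply_mem_toSubmodule g ht, rfl⟩ }
  have hT' : U ≤ T' := generatedBy_le fun w hw ↦
    ⟨⟨w, le_generatedBy hw⟩, le_generatedBy (ρ := U.toRepresentation) hw, rfl⟩
  refine eq_top_iff.2 fun x _ ↦ ?_
  obtain ⟨t, ht, htx⟩ := hT' x.2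
  rwa [Subtype.ext htx] at ht

end generatedBy

section eigenspace

variable {k G V : Type*} [Field k] [Group G] [AddCommGroup V] [Module k V]
  {N : Subgroup G} (β : N →* kˣ) (ρ : Representation k G V)

/-- The subspace on which `N` acts through the character `β`. -/
def charSpace : Submodule k V where
  carrier := {v | ∀ n : N, ρ n v = (β n : k) • v}
  add_mem' {v w} hv hw n := by rw [map_add, hv n, hw n, smul_add]
  zero_mem' n := by simp
  smul_mem' c v hv n := by rw [map_smul, hv n, smul_comm]

variable [Finite N]

/-- The projection onto the subspace on which `N` acts through the character `β`. -/
noncomputable def charProj : V →ₗ[k] V :=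
  letI := Fintype.ofFinite N
  (Nat.card N : k)⁻¹ • ∑ n : N, ((β n)⁻¹ : kˣ).1 • ρ n

variable {β ρ}

lemma charProj_apply [Fintype N] (v : V) :
    charProj β ρ v = (Nat.card N : k)⁻¹ • ∑ n : N, ((β n)⁻¹ : kˣ).1 • ρ n v := by
  rw [charProj, Subsingleton.elim (Fintype.ofFinite N) ‹_›]
  simp

lemma charProj_mem {p : Subrepresentation ρ} {v : V} (hv : v ∈ p) : charProj β ρ v ∈ p := by
  have := Fintype.ofFinite N
  rw [charProj_apply]
  exact Submodule.smul_mem _ _ (Submodule.sum_mem (p := p.toSubmodule) fun n _ ↦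
    Submodule.smul_mem _ _ (p.apply_mem_toSubmodule _ hv))

lemma charProj_eq_self [NeZero (Nat.card N : k)] {v : V} (hv : v ∈ charSpace β ρ) :
    charProj β ρ v = v := by
  have := Fintype.ofFinite N
  rw [charProj_apply, Finset.sum_congr rfl fun n _ ↦ show _ = v by
    rw [hv n, smul_smul, ← Units.val_mul, inv_mul_cancel, Units.val_one, one_smul]]
  rw [Finset.sum_const, Finset.card_univ, ← Nat.card_eq_fintype_card, ← Nat.cast_smul_eq_nsmul k,
    smul_smul, inv_mul_cancel₀ (NeZero.ne _), one_smul]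

lemma charProj_apply_apply (n : N) (v : V) :
    charProj β ρ (ρ n v) = (β n : k) • charProj β ρ v := by
  have := Fintype.ofFinite N
  rw [charProj_apply, charProj_apply, smul_comm (β n : k)]
  congr 1
  rw [Finset.smul_sum]
  refine Fintype.sum_equiv (M := V) (_root_.Equiv.mulRight n) _ _ fun m ↦ ?_
  rw [_root_.Equiv.coe_mulRight, Subgroup.coe_mul, map_mul, map_mul, Module.End.mul_apply,
    smul_smul, ← Units.val_mul]
  congr 2
  rw [mul_inv_rev, mul_inv_cancel_left]

lemma apply_conj_apply (g : G) (m : G) (v : V) :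
    ρ (g * m * g⁻¹) (ρ g v) = ρ g (ρ m v) := by
  rw [← Module.End.mul_apply, ← Module.End.mul_apply, ← map_mul, ← map_mul, inv_mul_cancel_right]

variable [hN : N.Normal]

lemma charProj_apply_eq_zero {v : V} (hv : v ∈ charSpace β ρ) {g : G} {m : N}
    (h : β ⟨g * m * g⁻¹, hN.conj_mem m m.2 g⟩ ≠ β m) : charProj β ρ (ρ g v) = 0 := by
  have h₁ := charProj_apply_apply (β := β) (ρ := ρ) ⟨g * m * g⁻¹, hN.conj_mem m m.2 g⟩ (ρ g v)
  rw [apply_conj_apply, hv m, map_smul, map_smul, ← sub_eq_zero, ← sub_smul, smul_eq_zero,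
    sub_eq_zero] at h₁
  exact h₁.resolve_left fun h₂ ↦ h (Units.ext h₂.symm)

variable {C : Subgroup G}

lemma charProj_mem_of_mem_generatedBy [NeZero (Nat.card N : k)]
    (hC : ∀ g : G, (∀ n : N, β ⟨g * n * g⁻¹, hN.conj_mem n n.2 g⟩ = β n) → g ∈ C)
    {W : Submodule k V} (hW : W ≤ charSpace β ρ) (hCW : ∀ g ∈ C, ∀ w ∈ W, ρ g w ∈ W)
    {v : V} (hv : v ∈ ρ.generatedBy W) : charProj β ρ v ∈ W := by
  suffices h : (⨆ g, W.map (ρ g)) ≤ W.comap (charProj β ρ) from h hv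
  refine iSup_le fun g ↦ ?_
  rintro _ ⟨w, hw, rfl⟩
  rw [Submodule.mem_comap]
  by_cases hg : g ∈ C
  · rw [charProj_eq_self (hW (hCW g hg w hw))]
    exact hCW g hg w hw
  · obtain ⟨m, hm⟩ := not_forall.1 (mt (hC g) hg)
    rw [charProj_apply_eq_zero (hW hw) hm]
    exact W.zero_mem

lemma isIrreducible_of_generatedBy_eq_top [Finite G] [NeZero (Nat.card G : k)]
    [NeZero (Nat.card N : k)]
    (hC : ∀ g : G, (∀ n : N, β ⟨g * n * g⁻¹, hN.conj_mem n n.2 g⟩ = β n) → g ∈ C)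
    {W : Submodule k V} (hW : W ≤ charSpace β ρ) (hCW : ∀ g ∈ C, ∀ w ∈ W, ρ g w ∈ W)
    (hW₀ : W ≠ ⊥)
    (hmin : ∀ W' ≤ W, (∀ g ∈ C, ∀ w ∈ W', ρ g w ∈ W') → W' = ⊥ ∨ W' = W)
    (htop : ρ.generatedBy W = ⊤) : IsIrreducible ρ := by
  have hproj (v : V) : charProj β ρ v ∈ W :=
    charProj_mem_of_mem_generatedBy hC hW hCW (htop ▸ Submodule.mem_top)
  have hle {U : Subrepresentation ρ} (h : W ≤ U.toSubmodule) : U = ⊤ :=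
    top_le_iff.1 (htop ▸ generatedBy_le h)
  obtain ⟨w₀, hw₀, hne⟩ := Submodule.exists_mem_ne_zero_of_ne_bot hW₀
  have : Nontrivial (Subrepresentation ρ) :=
    ⟨⊥, ⊤, fun h ↦ hne (show w₀ ∈ (⊥ : Subrepresentation ρ) from h ▸ Submodule.mem_top)⟩
  refine ⟨fun U ↦ ?_⟩
  rcases hmin (U.toSubmodule ⊓ W) inf_le_right
    fun g hg w hw ↦ ⟨U.apply_mem_toSubmodule g hw.1, hCW g hg w hw.2⟩ with h | h
  · obtain ⟨U', hU'⟩ := exists_isCompl U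
    have hU'top : U' = ⊤ := by
      refine hle fun w hw ↦ ?_
      have hw' : w ∈ (U ⊔ U').toSubmodule := hU'.sup_eq_top ▸ Submodule.mem_top
      obtain ⟨u, hu, u', hu', rfl⟩ := Submodule.mem_sup.1 hw'
      have hu₀ : charProj β ρ u = 0 :=
        (Submodule.mem_bot k).1 (h ▸ ⟨charProj_mem (p := U) hu, hproj u⟩)
      rw [← charProj_eq_self (hW hw), map_add, hu₀, zero_add]
      exact charProj_mem (p := U') hu'
    exact .inl (by simpa [hU'top] using hU'.inf_eq_bot)
  · exact .inr (hle (inf_eq_right.1 h))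

variable {χ : C →* kˣ} {hNC : N ≤ C} (hχ : ∀ n : N, χ ⟨n, hNC n.2⟩ = β n)

include hχ in
omit [Finite N] in
lemma apply_mem_charSpace {g : G} (hg : g ∈ C) {v : V} (hv : v ∈ charSpace β ρ) :
    ρ g v ∈ charSpace β ρ := by
  intro n
  let m : N := ⟨g⁻¹ * n * g, by simpa using hN.conj_mem n n.2 g⁻¹⟩
  have hm : β m = β n := by
    rw [← hχ, ← hχ]
    have : (⟨m, hNC m.2⟩ : C) = ⟨g, hg⟩⁻¹ * ⟨n, hNC n.2⟩ * ⟨g, hg⟩ := rfl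
    rw [this, map_mul, map_mul, map_inv, mul_right_comm, inv_mul_cancel, one_mul]
  have hn : (n : G) = g * m * g⁻¹ := by simp [m, mul_assoc]
  rw [hn, apply_conj_apply, hv m, map_smul, hm]

variable (ρ) in
/-- The representation of `C ⧸ N` on the subspace where `N` acts through `β`, obtained by
twisting with the inverse of an extension `χ` of `β` to `C`. -/
noncomputable def charRep : Representation k (C ⧸ N.subgroupOf C) (charSpace β ρ) :=
  QuotientGroup.lift (N.subgroupOf C)
    { toFun c := ((χ c)⁻¹ : kˣ).1 • (ρ c).restrict fun _ ↦ apply_mem_charSpace hχ c.2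
      map_one' := by ext; simp
      map_mul' c d := by
        ext v
        change ((χ (c * d))⁻¹ : kˣ).1 • ρ (c * d : G) v =
          ((χ c)⁻¹ : kˣ).1 • ρ c (((χ d)⁻¹ : kˣ).1 • ρ d v)
        rw [map_smul, smul_smul, ← Units.val_mul, ← mul_inv, map_mul, map_mul,
          Module.End.mul_apply] }
    (by
      intro c hc
      ext v
      have h := v.2 ⟨c, hc⟩
      have h' : χ c = β ⟨c, hc⟩ := hχ ⟨c, hc⟩
      simp only at h
      simp [h, h'])

omit [Finite N] in
lemma coe_charRep_mk_apply (c : C) (v : charSpace β ρ) :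
    (charRep ρ hχ (c : C ⧸ N.subgroupOf C) v : V) = ((χ c)⁻¹ : kˣ).1 • ρ c v := rfl

omit [Finite N] in
lemma apply_eq_smul_charRep (c : C) (v : charSpace β ρ) :
    ρ c v = (χ c).1 • (charRep ρ hχ (c : C ⧸ N.subgroupOf C) v : V) := by
  rw [coe_charRep_mk_apply, smul_smul, ← Units.val_mul, mul_inv_cancel, Units.val_one, one_smul]

/-- An equivalence of representations of `G` restricts to the subspaces on which `N` acts
through `β`. -/
noncomputable def Equiv.charRep {V' : Type*} [AddCommGroup V'] [Module k V']
    {ρ' : Representation k G V'} (e : ρ.Equiv ρ') :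
    (charRep ρ hχ).Equiv (charRep ρ' hχ) := by
  have he (g : G) (v : V) : e (ρ g v) = ρ' g (e v) := IntertwiningMap.isIntertwining _ _ e.1 g v
  have he' (g : G) (v : V') : e.symm (ρ' g v) = ρ g (e.symm v) :=
    IntertwiningMap.isIntertwining _ _ e.symm.1 g v
  refine Equiv.mk (LinearEquiv.ofSubmodules e.toLinearEquiv (charSpace β ρ) (charSpace β ρ') ?_) ?_
  · ext v
    constructor
    · rintro ⟨w, hw, rfl⟩ n
      change ρ' n (e w) = (β n : k) • e w
      rw [← he, hw n]
      exact map_smul e.toLinearEquiv _ _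
    · intro hv
      refine ⟨e.symm v, fun n ↦ ?_, e.apply_symm_apply v⟩
      rw [← he', hv n]
      exact map_smul e.symm.toLinearEquiv _ _
  · intro c
    induction c using QuotientGroup.induction_on with | H c =>
    ext v
    refine (map_smul e.toLinearEquiv _ _).trans ?_
    exact congr(_ • $(he c v))

lemma isIrreducible_charRep [NeZero (Nat.card N : k)] [IsIrreducible ρ]
    (hC : ∀ g : G, (∀ n : N, β ⟨g * n * g⁻¹, hN.conj_mem n n.2 g⟩ = β n) → g ∈ C)
    (hne : charSpace β ρ ≠ ⊥) : IsIrreducible (charRep ρ hχ) := by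
  obtain ⟨v₀, hv₀, hv₀'⟩ := Submodule.exists_mem_ne_zero_of_ne_bot hne
  have : Nontrivial (Subrepresentation (charRep ρ hχ)) := by
    refine ⟨⊥, ⊤, fun h ↦ hv₀' ?_⟩
    have : (⟨v₀, hv₀⟩ : charSpace β ρ) ∈ (⊥ : Subrepresentation (charRep ρ hχ)) :=
      h ▸ Submodule.mem_top
    exact congr_arg Subtype.val ((Submodule.mem_bot k).1 this)
  refine ⟨fun q ↦ or_iff_not_imp_left.2 fun hq ↦ ?_⟩
  let W : Submodule k V := q.toSubmodule.map (charSpace β ρ).subtype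
  have hW : W ≤ charSpace β ρ := Submodule.map_subtype_le _ _
  have hCW : ∀ g ∈ C, ∀ w ∈ W, ρ g w ∈ W := by
    rintro g hg _ ⟨w, hw, rfl⟩
    refine ⟨_, q.toSubmodule.smul_mem (χ ⟨g, hg⟩).1
      (q.apply_mem_toSubmodule (⟨g, hg⟩ : C) hw), ?_⟩
    exact (apply_eq_smul_charRep hχ ⟨g, hg⟩ w).symm
  have htop : ρ.generatedBy W = ⊤ := by
    refine (eq_bot_or_eq_top _).resolve_left fun h ↦ hq (eq_bot_iff.2 fun w hw ↦ ?_)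
    have : (w : V) ∈ ρ.generatedBy W := le_generatedBy ⟨w, hw, rfl⟩
    rw [h] at this
    exact (Submodule.mem_bot k).2 (Subtype.ext ((Submodule.mem_bot k).1 this))
  refine eq_top_iff.2 fun v _ ↦ ?_
  have hv : (v : V) ∈ W := by
    rw [← charProj_eq_self v.2]
    exact charProj_mem_of_mem_generatedBy hC hW hCW (htop ▸ Submodule.mem_top)
  obtain ⟨w, hw, hwv⟩ := hv
  rwa [Subtype.ext hwv] at hw

lemma nonempty_equiv_of_charRep_equiv [NeZero (Nat.card N : k)]
    {V' : Type*} [AddCommGroup V'] [Module k V'] {ρ' : Representation k G V'}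
    [IsIrreducible ρ] [IsIrreducible ρ']
    (hC : ∀ g : G, (∀ n : N, β ⟨g * n * g⁻¹, hN.conj_mem n n.2 g⟩ = β n) → g ∈ C)
    (hne : charSpace β ρ ≠ ⊥) (e : (charRep ρ hχ).Equiv (charRep ρ' hχ)) :
    Nonempty (ρ.Equiv ρ') := by
  obtain ⟨v₀, hv₀, hv₀'⟩ := Submodule.exists_mem_ne_zero_of_ne_bot hne
  have he_ne : ((e ⟨v₀, hv₀⟩ : charSpace β ρ') : V') ≠ 0 := by
    intro h
    refine hv₀' (congr_arg Subtype.val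
      ((map_eq_zero_iff e.toLinearEquiv e.toLinearEquiv.injective).1 (Subtype.ext h)))
  let W : Submodule k (V × V') := LinearMap.range
    ((charSpace β ρ).subtype.prod ((charSpace β ρ').subtype ∘ₗ e.toLinearEquiv.toLinearMap))
  have hW : W ≤ charSpace β (ρ.prod ρ') := by
    rintro _ ⟨w, rfl⟩ n
    exact Prod.ext (w.2 n) ((e w).2 n)
  have hCW : ∀ g ∈ C, ∀ w ∈ W, ρ.prod ρ' g w ∈ W := by
    rintro g hg _ ⟨w, rfl⟩
    refine ⟨(χ ⟨g, hg⟩).1 • charRep ρ hχ (⟨g, hg⟩ : C) w, Prod.ext ?_ ?_⟩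
    · exact (apply_eq_smul_charRep hχ ⟨g, hg⟩ w).symm
    · refine .trans (congr_arg Subtype.val (map_smul e.toLinearEquiv _ _)) ?_
      refine .trans ?_ (apply_eq_smul_charRep hχ ⟨g, hg⟩ (e w)).symm
      exact congr(_ • ($(IntertwiningMap.isIntertwining _ _ e.1 (⟨g, hg⟩ : C) w)).1)
  set U := (ρ.prod ρ').generatedBy W
  have hU₀ : (v₀, ((e ⟨v₀, hv₀⟩ : charSpace β ρ') : V')) ∈ U :=
    le_generatedBy ⟨⟨v₀, hv₀⟩, rfl⟩
  let ι : U.toRepresentation.IntertwiningMap (ρ.prod ρ') := ⟨U.toSubmodule.subtype, fun _ ↦ rfl⟩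
  let f := (IntertwiningMap.fst k ρ ρ').comp ι
  let K : Subrepresentation ρ' :=
    { toSubmodule := U.toSubmodule.comap (LinearMap.inr k V V')
      apply_mem_toSubmodule g v hv := by
        have := U.apply_mem_toSubmodule g hv
        simpa using this }
  have hK : K = ⊥ := by
    refine (eq_bot_or_eq_top K).resolve_right fun hK ↦ he_ne ?_
    have h₁ : ((0, ((e ⟨v₀, hv₀⟩ : charSpace β ρ') : V')) : V × V') ∈ U :=
      show _ ∈ K from hK ▸ Submodule.mem_top
    have h₂ : ((0, ((e ⟨v₀, hv₀⟩ : charSpace β ρ') : V')) : V × V') ∈ W := by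
      rw [← charProj_eq_self (β := β) (ρ := ρ.prod ρ')
        (v := (0, ((e ⟨v₀, hv₀⟩ : charSpace β ρ') : V')))
        fun n ↦ Prod.ext (by simp) ((e ⟨v₀, hv₀⟩).2 n)]
      exact charProj_mem_of_mem_generatedBy hC hW hCW h₁
    obtain ⟨w, hw⟩ := h₂
    have hw₀ : w = 0 := Subtype.ext congr(($hw).1)
    have hw₁ : ((e w : charSpace β ρ') : V') = e ⟨v₀, hv₀⟩ := congr(($hw).2)
    rw [← hw₁, hw₀]
    exact congr_arg Subtype.val (map_zero e.toLinearEquiv)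
  have hf : Function.Bijective f := by
    constructor
    · refine (injective_iff_map_eq_zero f.toLinearMap).2 fun ⟨⟨x, y⟩, hu⟩ hx ↦ ?_
      obtain rfl : x = 0 := hx
      have hy : y ∈ K := hu
      rw [hK] at hy
      obtain rfl : y = 0 := hy
      rfl
    · refine (IsIrreducible.surjective_or_eq_zero f).resolve_right fun h ↦ hv₀' ?_
      exact congr($h ⟨_, hU₀⟩)
  let F := ((IntertwiningMap.snd k ρ ρ').comp ι).comp (f.ofBijective hf).symm.toIntertwiningMap
  refine ⟨F.ofBijective ((IsIrreducible.bijective_or_eq_zero F).resolve_right fun h ↦ he_ne ?_)⟩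
  have h₁ : (f.ofBijective hf).symm v₀ = ⟨_, hU₀⟩ :=
    (f.ofBijective hf).symm_apply_apply ⟨_, hU₀⟩
  have h₂ : ((f.ofBijective hf).symm v₀ : V × V').2 = 0 := congr($h v₀)
  rwa [h₁] at h₂

/-- The embedding of the inflation of `τ` to `C`, twisted by `χ`, into the functions on `G`,
where `w` is sent to the function supported on `C` with value `w` at `1`. -/
noncomputable def extendByZero {W : Type*} [AddCommGroup W] [Module k W]
    (τ : Representation k (C ⧸ N.subgroupOf C) W) (χ : C →* kˣ) : W →ₗ[k] (G → W) :=
  open Classical in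
  LinearMap.pi fun x ↦ if h : x ∈ C then (χ ⟨x, h⟩).1 • τ (⟨x, h⟩ : C) else 0

/-- The action of `G` by right translation on functions with values in `W`. -/
def rightTranslation (k G W : Type*) [Field k] [Group G] [AddCommGroup W] [Module k W] :
    Representation k G (G → W) where
  toFun g := LinearMap.funLeft k W (· * g)
  map_one' := by ext; simp
  map_mul' g h := by ext; simp [LinearMap.funLeft, mul_assoc]

section

omit [Finite N]

variable {W : Type*} [AddCommGroup W] [Module k W]
  {τ : Representation k (C ⧸ N.subgroupOf C) W}

lemma rightTranslation_extendByZero (c : C) (w : W) :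
    rightTranslation k G W c (extendByZero τ χ w) =
      (χ c).1 • extendByZero τ χ (τ (c : C ⧸ N.subgroupOf C) w) := by
  ext x
  change extendByZero τ χ w (x * c) = (χ c).1 • extendByZero τ χ (τ c w) x
  by_cases hx : x ∈ C
  · have hxc : x * c ∈ C := C.mul_mem hx c.2
    have h : (⟨x * c, hxc⟩ : C) = ⟨x, hx⟩ * c := rfl
    simp only [extendByZero, LinearMap.pi_apply, hx, hxc, dif_pos]
    rw [h, QuotientGroup.mk_mul, map_mul, map_mul, LinearMap.smul_apply, LinearMap.smul_apply,
      smul_smul, Module.End.mul_apply, Units.val_mul, mul_comm]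
  · have hxc : x * c ∉ C := mt (C.mul_mem_cancel_right c.2).1 hx
    simp [extendByZero, hx, hxc]

lemma extendByZero_injective : Function.Injective (extendByZero τ χ) := by
  intro v w h
  have h₁ : (⟨1, C.one_mem⟩ : C) = 1 := rfl
  simpa [extendByZero, C.one_mem, h₁] using congr_fun h 1

include hχ in
lemma extendByZero_mem_charSpace (w : W) :
    extendByZero τ χ w ∈ charSpace β (rightTranslation k G W) := by
  intro n
  have h := rightTranslation_extendByZero (τ := τ) (χ := χ) ⟨n, hNC n.2⟩ w
  have hn : ((⟨n, hNC n.2⟩ : C) : C ⧸ N.subgroupOf C) = 1 :=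
    (QuotientGroup.eq_one_iff _).2 n.2
  rwa [hn, hχ, map_one] at h

end

lemma exists_isIrreducible_charRep_equiv [Finite G] [NeZero (Nat.card G : k)]
    [NeZero (Nat.card N : k)]
    (hC : ∀ g : G, (∀ n : N, β ⟨g * n * g⁻¹, hN.conj_mem n n.2 g⟩ = β n) → g ∈ C)
    {W : Type*} [AddCommGroup W] [Module k W] (τ : Representation k (C ⧸ N.subgroupOf C) W)
    [IsIrreducible τ] :
    ∃ U : Subrepresentation (rightTranslation k G W), IsIrreducible U.toRepresentation ∧
      Nonempty ((charRep U.toRepresentation hχ).Equiv τ) := by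
  let U := (rightTranslation k G W).generatedBy (LinearMap.range (extendByZero τ χ))
  let ι : W →ₗ[k] U.toSubmodule := (extendByZero τ χ).codRestrict U.toSubmodule
    fun w ↦ le_generatedBy ⟨w, rfl⟩
  have hι : Function.Injective ι := fun v w h ↦ extendByZero_injective congr(($h).1)
  have hιapply (c : C) (w : W) : U.toRepresentation c (ι w) = (χ c).1 • ι (τ c w) :=
    Subtype.ext (rightTranslation_extendByZero c w)
  have hιmem (w : W) : ι w ∈ charSpace β U.toRepresentation := fun n ↦
    Subtype.ext (extendByZero_mem_charSpace hχ w n)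
  have hW : LinearMap.range ι ≤ charSpace β U.toRepresentation := by
    rintro _ ⟨w, rfl⟩
    exact hιmem w
  have hCW : ∀ g ∈ C, ∀ w ∈ LinearMap.range ι, U.toRepresentation g w ∈ LinearMap.range ι := by
    rintro g hg _ ⟨w, rfl⟩
    rw [hιapply ⟨g, hg⟩]
    exact Submodule.smul_mem _ _ ⟨_, rfl⟩
  have htop : U.toRepresentation.generatedBy (LinearMap.range ι) = ⊤ := by
    rw [← generatedBy_comap_subtype (ρ := rightTranslation k G W)
      (W := LinearMap.range (extendByZero τ χ))]
    congr 1
    ext x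
    exact ⟨fun ⟨w, hw⟩ ↦ ⟨w, congr_arg Subtype.val hw⟩, fun ⟨w, hw⟩ ↦ ⟨w, Subtype.ext hw⟩⟩
  have hW₀ : LinearMap.range ι ≠ ⊥ := by
    intro h
    refine bot_ne_top (α := Subrepresentation τ) (eq_top_iff.2 fun w _ ↦ ?_)
    have hw : ι w ∈ (⊥ : Submodule k U.toSubmodule) := h ▸ ⟨w, rfl⟩
    exact (map_eq_zero_iff ι hι).1 hw
  have hmin : ∀ W' ≤ LinearMap.range ι, (∀ g ∈ C, ∀ w ∈ W', U.toRepresentation g w ∈ W') →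
      W' = ⊥ ∨ W' = LinearMap.range ι := by
    intro W' hle hst
    let T : Subrepresentation τ :=
      { toSubmodule := W'.comap ι
        apply_mem_toSubmodule g v hv := by
          induction g using QuotientGroup.induction_on with | H c =>
          have h := W'.smul_mem ((χ c)⁻¹ : kˣ).1 (hst c c.2 _ hv)
          rwa [hιapply, smul_smul, ← Units.val_mul, inv_mul_cancel, Units.val_one, one_smul] at h }
    rcases eq_bot_or_eq_top T with h | h
    · refine .inl (eq_bot_iff.2 fun x hx ↦ ?_)
      obtain ⟨w, rfl⟩ := hle hx
      have hw : w ∈ T := hx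
      rw [h] at hw
      obtain rfl : w = 0 := hw
      exact map_zero ι
    · refine .inr (le_antisymm hle ?_)
      rintro _ ⟨w, rfl⟩
      exact show w ∈ T from h ▸ Submodule.mem_top
  refine ⟨U, isIrreducible_of_generatedBy_eq_top hC hW hCW hW₀ hmin htop, ?_⟩
  have hsurj : Function.Surjective (ι.codRestrict _ hιmem) := by
    intro v
    obtain ⟨w, hw⟩ : (v : U.toSubmodule) ∈ LinearMap.range ι := by
      rw [← charProj_eq_self v.2]
      exact charProj_mem_of_mem_generatedBy hC hW hCW (htop ▸ Submodule.mem_top)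
    exact ⟨w, Subtype.ext hw⟩
  let F : τ.IntertwiningMap (charRep U.toRepresentation hχ) :=
    ⟨ι.codRestrict _ hιmem, fun g ↦ by
      induction g using QuotientGroup.induction_on with | H c =>
      ext w : 2
      change ι (τ c w) = ((χ c)⁻¹ : kˣ).1 • U.toRepresentation c (ι w)
      rw [hιapply, smul_smul, ← Units.val_mul, inv_mul_cancel, Units.val_one, one_smul]⟩
  exact ⟨(F.ofBijective ⟨fun v w h ↦ hι congr(($h).1), hsurj⟩).symm⟩

end eigenspace

end Representation

/-- Clifford theory counting: let `Γ` be a finite group, `N ⊴ Γ`, and `β` a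
one-dimensional character of `N` with stabiliser `C` in `Γ`.  If `β` extends to `C`,
then the number of isomorphism classes of irreducible complex representations of `Γ`
lying above `β` equals the number of isomorphism classes of irreducible complex
representations of `C/N`. -/
theorem stmt_9 (Γ : Type) [Group Γ] [Finite Γ]
    (N : Subgroup Γ) [hN : N.Normal] (β : N →* ℂˣ)
    (C : Subgroup Γ)
    (hC : ∀ g : Γ, g ∈ C ↔ ∀ n : N, β ⟨g * n * g⁻¹, hN.conj_mem n n.2 g⟩ = β n)
    (hNC : N ≤ C)
    (hext : ∃ β' : C →* ℂˣ, ∀ n : N, β' ⟨n, hNC n.2⟩ = β n) :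
    Nat.card (Quot (fun (X Y : {X : FDRep ℂ Γ // Simple X ∧ LiesAbove N β X}) =>
          Nonempty (X.1 ≅ Y.1))) =
      Nat.card (Quot (fun (X Y : {Y : FDRep ℂ (C ⧸ N.subgroupOf C) // Simple Y}) =>
        Nonempty (X.1 ≅ Y.1))) := by
  obtain ⟨χ, hχ⟩ := hext
  have : NeZero (Nat.card Γ : ℂ) := ⟨Nat.cast_ne_zero.2 Nat.card_pos.ne'⟩
  have : NeZero (Nat.card N : ℂ) := ⟨Nat.cast_ne_zero.2 Nat.card_pos.ne'⟩
  have hC' := fun g ↦ (hC g).2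
  have hne {X : FDRep ℂ Γ} (hX : LiesAbove N β X) : Representation.charSpace β X.ρ ≠ ⊥ := by
    obtain ⟨v, hv₀, hv⟩ := hX
    exact (Submodule.ne_bot_iff _).2 ⟨v, hv, hv₀⟩
  let F (X : {X : FDRep ℂ Γ // Simple X ∧ LiesAbove N β X}) :
      {Y : FDRep ℂ (C ⧸ N.subgroupOf C) // Simple Y} :=
    ⟨FDRep.of (Representation.charRep X.1.ρ hχ), by
      have := FDRep.simple_iff_isIrreducible.1 X.2.1
      exact FDRep.simple_iff_isIrreducible.2
        (Representation.isIrreducible_charRep hχ hC' (hne X.2.2))⟩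
  refine Nat.card_congr (Equiv.ofBijective (Quot.map F fun X Y h ↦ ?_) ⟨?_, ?_⟩)
  · obtain ⟨e⟩ := FDRep.nonempty_iso_iff.1 h
    exact FDRep.nonempty_iso_iff.2 ⟨e.charRep hχ⟩
  · rintro ⟨X⟩ ⟨Y⟩ h
    have hequiv : Equivalence fun X Y : {Y : FDRep ℂ (C ⧸ N.subgroupOf C) // Simple Y} ↦
        Nonempty (X.1 ≅ Y.1) :=
      ⟨fun X ↦ ⟨Iso.refl _⟩, fun ⟨i⟩ ↦ ⟨i.symm⟩, fun ⟨i⟩ ⟨j⟩ ↦ ⟨i.trans j⟩⟩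
    obtain ⟨e⟩ := FDRep.nonempty_iso_iff.1 ((Equivalence.quot_mk_eq_iff hequiv _ _).1 h)
    have := FDRep.simple_iff_isIrreducible.1 X.2.1
    have := FDRep.simple_iff_isIrreducible.1 Y.2.1
    exact Quot.sound (FDRep.nonempty_iso_iff.2
      (Representation.nonempty_equiv_of_charRep_equiv hχ hC' (hne X.2.2) e))
  · rintro ⟨Y⟩
    have := FDRep.simple_iff_isIrreducible.1 Y.2
    obtain ⟨U, hU, ⟨e⟩⟩ := Representation.exists_isIrreducible_charRep_equiv hχ hC' Y.1.ρ
    have habove : LiesAbove N β (FDRep.of U.toRepresentation) := by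
      obtain ⟨y, hy⟩ : ∃ y : Y.1, y ≠ 0 := by
        by_contra! h
        exact bot_ne_top (α := Subrepresentation Y.1.ρ) (eq_top_iff.2 fun y _ ↦ h y)
      refine ⟨e.symm y, fun h ↦ hy ?_, (e.symm y).2⟩
      exact (map_eq_zero_iff e.symm.toLinearEquiv e.symm.toLinearEquiv.injective).1
        (Subtype.ext h)
    exact ⟨Quot.mk _ ⟨FDRep.of U.toRepresentation, FDRep.simple_iff_isIrreducible.2 hU, habove⟩,
      Quot.sound (FDRep.nonempty_iso_iff.2 ⟨e⟩)⟩
end
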